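/- arXiv:0810.0557 — 8 statements merged into one kernel-verified Lean document; each statement's English description precedes it below -/
import Mathlib

section
/- The equilibrium distribution of the Markov chain is unique: since the graph G is connected, the kernel of M is one-dimensional; more precisely, every vector v ∈ ℝ^S with M v = 0 is a scalar multiple of the Gibbs–Boltzmann distribution ρ̄. -/
open Finset in
/-- Discrete maximum principle: a function on a finite connected graph that is harmonic for
positive edge weights is constant. -/
theorem SimpleGraph.Connected.eq_of_weighted_harmonic
    {S : Type*} [Fintype S] [Nonempty S] {G : SimpleGraph S} [DecidableRel G.Adj]
    (hG : G.Connected) {a : S → S → ℝ} (ha : ∀ i j, G.Adj i j → 0 < a i j)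
    {u : S → ℝ} (hu : ∀ i, ∑ k ∈ G.neighborFinset i, a i k * (u i - u k) = 0) :
    ∀ i j, u i = u j := by
  obtain ⟨m, hm⟩ := Finite.exists_max u
  have step : ∀ i j, G.Adj i j → u i = u m → u j = u m := by
    intro i j hij hi
    have hnonneg : ∀ k ∈ G.neighborFinset i, 0 ≤ a i k * (u i - u k) := by
      intro k hk
      rw [SimpleGraph.mem_neighborFinset] at hk
      exact mul_nonneg (ha i k hk).le (by linarith [hm k])
    have hzero := (sum_eq_zero_iff_of_nonneg hnonneg).1 (hu i) j (by simpa using hij)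
    rcases mul_eq_zero.1 hzero with h | h
    · exact absurd h (ha i j hij).ne'
    · linarith
  have hconst : ∀ i, u i = u m := by
    have hwalk : ∀ i j, G.Walk i j → u i = u m → u j = u m := by
      intro i j p
      induction p with
      | nil => exact id
      | cons h _ ih => exact fun hi => ih (step _ _ h hi)
    intro i
    obtain ⟨p⟩ := hG.preconnected m i
    exact hwalk m i p rfl
  exact fun i j => (hconst i).trans (hconst j).symm


/-- Uniqueness of the equilibrium distribution: every `v` with `M v = 0`
is a scalar multiple of the Gibbs–Boltzmann distribution `ρ̄`. -/
theorem kernel_one_dimensional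
    {S : Type*} [Fintype S] [DecidableEq S] [Nonempty S]
    (E : S → ℝ) (β : ℝ) (hβ : 0 < β)
    (G : SimpleGraph S) [DecidableRel G.Adj] (hG : G.Connected)
    (w : S → S → ℝ) (hw_symm : ∀ i j, w i j = w j i)
    (hw_pos : ∀ i j, G.Adj i j → 0 < w i j)
    (Z : ℝ) (hZ : Z = ∑ i, Real.exp (-β * E i))
    (ρ : S → ℝ) (hρ : ∀ i, ρ i = Real.exp (-β * E i) / Z)
    (M : Matrix S S ℝ)
    (hM : ∀ i j, M i j =
      if G.Adj i j then w i j * Real.exp (β * (E j - E i) / 2)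
      else if i = j then
        -∑ k ∈ G.neighborFinset i, w k i * Real.exp (β * (E i - E k) / 2)
      else 0)
    :
    ∀ v : S → ℝ, M.mulVec v = 0 → ∃ c : ℝ, v = c • ρ := by
  intro v hv
  have hu : ∀ i, ∑ k ∈ G.neighborFinset i,
      w i k * Real.exp (-β * (E i + E k) / 2) *
        (v i * Real.exp (β * E i) - v k * Real.exp (β * E k)) = 0 := by
    intro i
    have hi : ∑ j, M i j * v j = 0 := congrFun hv i
    have hsplit : ∀ j, M i j * v j =
        (if G.Adj i j then w i j * Real.exp (β * (E j - E i) / 2) * v j else 0) +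
        (if i = j then
          (-∑ k ∈ G.neighborFinset i, w k i * Real.exp (β * (E i - E k) / 2)) * v j
        else 0) := by
      intro j
      rw [hM]
      by_cases hij : G.Adj i j
      · simp [hij, hij.ne]
      · by_cases h : i = j <;> simp [hij, h]
    simp_rw [hsplit] at hi
    rw [Finset.sum_add_distrib, Finset.sum_ite_eq, if_pos (Finset.mem_univ i),
      ← Finset.sum_filter, ← SimpleGraph.neighborFinset_eq_filter, neg_mul, Finset.sum_mul,
      ← sub_eq_add_neg, ← Finset.sum_sub_distrib] at hi
    rw [← neg_eq_zero, ← Finset.sum_neg_distrib, ← hi]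
    refine Finset.sum_congr rfl fun k _ => ?_
    have h₁ : Real.exp (β * (E k - E i) / 2) =
        Real.exp (-β * (E i + E k) / 2) * Real.exp (β * E k) := by
      rw [← Real.exp_add]; congr 1; ring
    have h₂ : Real.exp (β * (E i - E k) / 2) =
        Real.exp (-β * (E i + E k) / 2) * Real.exp (β * E i) := by
      rw [← Real.exp_add]; congr 1; ring
    rw [h₁, h₂, hw_symm k i]
    ring
  have hconst := hG.eq_of_weighted_harmonic
    (a := fun i k => w i k * Real.exp (-β * (E i + E k) / 2))
    (u := fun i => v i * Real.exp (β * E i))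
    (fun i j hij => mul_pos (hw_pos i j hij) (Real.exp_pos _)) hu
  have hZ_pos : 0 < Z :=
    hZ ▸ Finset.sum_pos (fun i _ => Real.exp_pos _) Finset.univ_nonempty
  obtain ⟨m⟩ := ‹Nonempty S›
  refine ⟨v m * Real.exp (β * E m) * Z, funext fun i => ?_⟩
  have him : v i * Real.exp (β * E i) = v m * Real.exp (β * E m) := hconst i m
  rw [Pi.smul_apply, smul_eq_mul, hρ, mul_assoc, mul_div_cancel₀ _ hZ_pos.ne', ← him,
    mul_assoc, ← Real.exp_add]
  simp
end

section
/- Let α ∈ ℝ with α ≠ 1 and α ≠ −1, and let ρ : ℝ → ℝ^S be differentiable with ρ_i(t) > 0 for all i and t, satisfying the Markov dynamics ρ̇ = M ρ. Then the α-representation ψ^{(α)}_i(t) = (2/(1−α)) ρ_i(t)^{(1−α)/2} satisfies, for every i ∈ S and t ∈ ℝ, the evolution equation ψ̇^{(α)}_i = ((1−α)/2) Σ_{j∈S} ρ_i^{−(1+α)/2} m_ij ρ_j^{(1+α)/2} ψ^{(α)}_j; equivalently, ψ̇^{(α)} = ((1−α)/2) H^{(−α)} ψ^{(α)}, where H^{(−α)}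 = (Ψ^{(−α)})^{−1} M Ψ^{(−α)} with Ψ^{(−α)} = diag((2/(1+α)) ρ_i^{(1+α)/2}). -/
/-- Time evolution of the `α`-representation: if `ρ̇ = M ρ` (componentwise)
with `ρ` positive, then `ψ^{(α)}_i = (2/(1-α)) ρ_i^{(1-α)/2}` satisfies
`ψ̇^{(α)}_i = ((1-α)/2) Σ_j ρ_i^{-(1+α)/2} m_ij ρ_j^{(1+α)/2} ψ^{(α)}_j`. -/
theorem alpha_representation_evolution
    {S : Type*} [Fintype S] [DecidableEq S] [Nonempty S]
    (E : S → ℝ) (β : ℝ) (hβ : 0 < β)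
    (G : SimpleGraph S) [DecidableRel G.Adj] (hG : G.Connected)
    (w : S → S → ℝ) (hw_symm : ∀ i j, w i j = w j i)
    (hw_pos : ∀ i j, G.Adj i j → 0 < w i j)
    (M : Matrix S S ℝ)
    (hM : ∀ i j, M i j =
      if G.Adj i j then w i j * Real.exp (β * (E j - E i) / 2)
      else if i = j then
        -∑ k ∈ G.neighborFinset i, w k i * Real.exp (β * (E i - E k) / 2)
      else 0)
    (α : ℝ) (hα1 : α ≠ 1) (hα2 : α ≠ -1)
    (ρ : ℝ → S → ℝ) (hρ_pos : ∀ t i, 0 < ρ t i)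
    (hdyn : ∀ i t, HasDerivAt (fun s => ρ s i) (∑ j, M i j * ρ t j) t)
    (ψ : ℝ → S → ℝ)
    (hψ : ∀ t i, ψ t i = (2 / (1 - α)) * (ρ t i) ^ ((1 - α) / 2)) :
    ∀ i t, HasDerivAt (fun s => ψ s i)
      ((1 - α) / 2 *
        ∑ j, (ρ t i) ^ (-(1 + α) / 2) * M i j * (ρ t j) ^ ((1 + α) / 2) * ψ t j) t := by
  intro i t
  have hα : 1 - α ≠ 0 := sub_ne_zero.mpr hα1.symm
  have hψ_fun : (fun s => ψ s i) = fun s => (2 / (1 - α)) * (ρ s i) ^ ((1 - α) / 2) :=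
    funext fun s => hψ s i
  rw [hψ_fun]
  have hderiv := ((hdyn i t).rpow_const (p := (1 - α) / 2)
    (Or.inl (hρ_pos t i).ne')).const_mul (2 / (1 - α))
  refine hderiv.congr_deriv ?_
  have hexp : (1 - α) / 2 - 1 = -(1 + α) / 2 := by ring
  rw [hexp, Finset.sum_mul, Finset.sum_mul, Finset.mul_sum, Finset.mul_sum]
  refine Finset.sum_congr rfl fun j _ => ?_
  have hmul : (ρ t j) ^ ((1 + α) / 2) * (ρ t j) ^ ((1 - α) / 2) = ρ t j := by
    rw [← Real.rpow_add (hρ_pos t j), show (1 + α) / 2 + (1 - α) / 2 = 1 by ring,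
      Real.rpow_one]
  rw [hψ t j]
  calc
    _ = (ρ t i) ^ (-(1 + α) / 2) * M i j * ρ t j := by
      field_simp
    _ = (ρ t i) ^ (-(1 + α) / 2) * M i j *
        ((ρ t j) ^ ((1 + α) / 2) * (ρ t j) ^ ((1 - α) / 2)) := by rw [hmul]
    _ = _ := by
      field_simp
end

section
/- Let d = max_{i,j∈S} |E_i − E_j|, w_max = max_{(ij)∈L} w_ij, w_min = min_{(ij)∈L} w_ij, χ = e^{−βd/2}/w_max, b = 1 + max_{i∈S} Σ_{k:(ki)∈L} w_ki/w_max, and ℳ = (bI + χH̄^{(0)})^N. Then every entry of ℳ is strictly positive, and the quantity κ = max_{i,j,k} ℳ_ik/ℳ_jk satisfies κ ≤ (3N/(w_min χ))^N. -/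
namespace Matrix

variable {S : Type*} [Fintype S] [DecidableEq S]

theorem pow_apply_le_of_row_sum_le {A : Matrix S S ℝ} (hA : ∀ i j, 0 ≤ A i j) {R : ℝ}
    (hR : ∀ i, ∑ j, A i j ≤ R) (n : ℕ) (i j : S) : (A ^ n) i j ≤ R ^ n := by
  induction n generalizing i j with
  | zero => rw [pow_zero, pow_zero, one_apply]; split_ifs <;> norm_num
  | succ n ih =>
    have hR₀ : 0 ≤ R := (Finset.sum_nonneg fun k _ => hA i k).trans (hR i)
    rw [pow_succ', mul_apply]
    calc ∑ k, A i k * (A ^ n) k j ≤ ∑ k, A i k * R ^ n :=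
          Finset.sum_le_sum fun k _ => mul_le_mul_of_nonneg_left (ih k j) (hA i k)
      _ = (∑ k, A i k) * R ^ n := by rw [Finset.sum_mul]
      _ ≤ R * R ^ n := mul_le_mul_of_nonneg_right (hR i) (pow_nonneg hR₀ n)
      _ = R ^ (n + 1) := (pow_succ' R n).symm

theorem pow_le_pow_apply_of_walk {A : Matrix S S ℝ} (hA : ∀ i j, 0 ≤ A i j)
    {G : SimpleGraph S} {m : ℝ} (hm : 0 ≤ m) (hdiag : ∀ i, m ≤ A i i)
    (hadj : ∀ i j, G.Adj i j → m ≤ A i j) (n : ℕ) {i j : S} (p : G.Walk i j)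
    (hp : p.length ≤ n) : m ^ n ≤ (A ^ n) i j := by
  have step (n : ℕ) (i v j : S) (h : m ≤ A i v) (h' : m ^ n ≤ (A ^ n) v j) :
      m ^ (n + 1) ≤ (A ^ (n + 1)) i j := by
    rw [pow_succ', pow_succ', mul_apply]
    exact (mul_le_mul h h' (pow_nonneg hm n) (hA i v)).trans
      (Finset.single_le_sum (f := fun k => A i k * (A ^ n) k j)
        (fun k _ => mul_nonneg (hA i k) (pow_apply_nonneg hA n k j)) (Finset.mem_univ v))
  induction n generalizing i with
  | zero =>
    cases p with
    | nil => simp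
    | cons h q => simp at hp
  | succ n ih =>
    cases p with
    | nil => exact step n j j j (hdiag j) (ih .nil (by simp))
    | cons h q => exact step n i _ j (hadj _ _ h) (ih q (by simpa using hp))

end Matrix

/-- `ℳ = (b I + χ H̄⁰)^N` is entrywise strictly positive and
`κ = max_{i,j,k} ℳ_ik / ℳ_jk` satisfies `κ ≤ (3N/(w_min χ))^N`. -/
theorem kappa_upper_bound
    {S : Type*} [Fintype S] [DecidableEq S] [Nonempty S]
    (N : ℕ) (hN : 1 ≤ N) (hcard : Fintype.card S = N)
    (E : S → ℝ) (β : ℝ) (hβ : 0 < β)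
    (G : SimpleGraph S) [DecidableRel G.Adj] (hG : G.Connected)
    (w : S → S → ℝ) (hw_symm : ∀ i j, w i j = w j i)
    (hw_pos : ∀ i j, G.Adj i j → 0 < w i j)
    (H : Matrix S S ℝ)
    (hH : ∀ i j, H i j =
      if G.Adj i j then w i j
      else if i = j then
        -∑ k ∈ G.neighborFinset i, w k i * Real.exp (β * (E i - E k) / 2)
      else 0)
    (d : ℝ) (hd : IsGreatest {r : ℝ | ∃ i j, r = |E i - E j|} d)
    (wmax : ℝ) (hwmax : IsGreatest {r : ℝ | ∃ i j, G.Adj i j ∧ r = w i j} wmax)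
    (χ : ℝ) (hχ : χ = Real.exp (-β * d / 2) / wmax)
    (b : ℝ)
    (hb : IsGreatest {r : ℝ | ∃ i, r = ∑ k ∈ G.neighborFinset i, w k i / wmax} (b - 1))
    (wmin : ℝ) (hwmin : IsLeast {r : ℝ | ∃ i j, G.Adj i j ∧ r = w i j} wmin)
    (ℳ : Matrix S S ℝ) (hℳ : ℳ = (b • (1 : Matrix S S ℝ) + χ • H) ^ N)
    (κ : ℝ) (hκ : IsGreatest {r : ℝ | ∃ i j k, r = ℳ i k / ℳ j k} κ) :
    (∀ i j, 0 < ℳ i j) ∧ κ ≤ (3 * N / (wmin * χ)) ^ N := by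
  obtain ⟨i₀, j₀, hadj₀, hwmax₀⟩ := hwmax.1
  obtain ⟨i₁, j₁, hadj₁, hwmin₁⟩ := hwmin.1
  have hmax : 0 < wmax := hwmax₀ ▸ hw_pos _ _ hadj₀
  have hmin : 0 < wmin := hwmin₁ ▸ hw_pos _ _ hadj₁
  have hle (i j : S) (h : G.Adj i j) : w i j ≤ wmax := hwmax.2 ⟨i, j, h, rfl⟩
  have hge (i j : S) (h : G.Adj i j) : wmin ≤ w i j := hwmin.2 ⟨i, j, h, rfl⟩
  have hE (i j : S) : E i - E j ≤ d := (le_abs_self _).trans (hd.2 ⟨i, j, rfl⟩)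
  have hd₀ : 0 ≤ d := by simpa using hE i₀ i₀
  have hχ₀ : 0 < χ := hχ ▸ div_pos (Real.exp_pos _) hmax
  have hχw (i j : S) (h : G.Adj i j) : χ * w i j ≤ 1 := by
    have hexp : Real.exp (-β * d / 2) ≤ 1 :=
      Real.exp_le_one_iff.2 (by nlinarith [mul_nonneg hβ.le hd₀])
    calc χ * w i j ≤ χ * wmax := mul_le_mul_of_nonneg_left (hle i j h) hχ₀.le
      _ = Real.exp (-β * d / 2) := by rw [hχ]; field_simp
      _ ≤ 1 := hexp
  have hm : 0 < wmin * χ := mul_pos hmin hχ₀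
  have hm₁ : wmin * χ ≤ 1 := by
    have := hχw i₁ j₁ hadj₁
    rwa [← hwmin₁, mul_comm] at this
  have hbN : b ≤ N := by
    obtain ⟨i, hi⟩ := hb.1
    have hsum : ∑ k ∈ G.neighborFinset i, w k i / wmax ≤ (G.degree i : ℝ) := by
      rw [← G.card_neighborFinset_eq_degree, ← nsmul_one]
      refine Finset.sum_le_card_nsmul _ _ _ fun k hk => ?_
      exact (div_le_one hmax).2 (hle _ _ ((G.mem_neighborFinset i k).1 hk).symm)
    have hdeg : (G.degree i : ℝ) + 1 ≤ N := by
      exact_mod_cast hcard ▸ G.degree_lt_card_verts i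
    linarith
  set A := b • (1 : Matrix S S ℝ) + χ • H with hA
  have hAdiag (i : S) : A i i = b -
      χ * ∑ k ∈ G.neighborFinset i, w k i * Real.exp (β * (E i - E k) / 2) := by
    simp [hA, hH]
    ring
  have hAadj (i j : S) (h : G.Adj i j) : A i j = χ * w i j := by
    simp [hA, hH, h, h.ne]
  have hAelse (i j : S) (h : ¬ G.Adj i j) (hij : i ≠ j) : A i j = 0 := by
    simp [hA, hH, h, hij]
  have hdiag (i : S) : 1 ≤ A i i := by
    have hsum : χ * ∑ k ∈ G.neighborFinset i, w k i * Real.exp (β * (E i - E k) / 2) ≤ b - 1 := by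
      refine le_trans ?_ (hb.2 ⟨i, rfl⟩)
      rw [Finset.mul_sum]
      refine Finset.sum_le_sum fun k hk => ?_
      have hwk := hw_pos _ _ ((G.mem_neighborFinset i k).1 hk).symm
      have hexp : Real.exp (-β * d / 2) * Real.exp (β * (E i - E k) / 2) ≤ 1 := by
        rw [← Real.exp_add, Real.exp_le_one_iff]
        nlinarith [mul_le_mul_of_nonneg_left (hE i k) hβ.le]
      calc χ * (w k i * Real.exp (β * (E i - E k) / 2))
          = w k i / wmax * (Real.exp (-β * d / 2) * Real.exp (β * (E i - E k) / 2)) := by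
            rw [hχ]; ring
        _ ≤ w k i / wmax * 1 := mul_le_mul_of_nonneg_left hexp (div_pos hwk hmax).le
        _ = w k i / wmax := mul_one _
    rw [hAdiag]
    linarith
  have hA₀ (i j : S) : 0 ≤ A i j := by
    by_cases h : G.Adj i j
    · rw [hAadj i j h]
      exact (mul_pos hχ₀ (hw_pos i j h)).le
    · by_cases hij : i = j
      · subst hij
        exact zero_le_one.trans (hdiag i)
      · exact (hAelse i j h hij).ge
  have hAle (i j : S) : A i j ≤ (if i = j then (N : ℝ) else 0) + 1 := by
    by_cases hij : i = j
    · subst hij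
      rw [hAdiag, if_pos rfl]
      have : 0 ≤ χ * ∑ k ∈ G.neighborFinset i, w k i * Real.exp (β * (E i - E k) / 2) :=
        mul_nonneg hχ₀.le <| Finset.sum_nonneg fun k hk => mul_nonneg
          (hw_pos _ _ ((G.mem_neighborFinset i k).1 hk).symm).le (Real.exp_pos _).le
      linarith
    · rw [if_neg hij, zero_add]
      by_cases h : G.Adj i j
      · rw [hAadj i j h]
        exact hχw i j h
      · rw [hAelse i j h hij]
        exact zero_le_one
  have hrow (i : S) : ∑ j, A i j ≤ 3 * N := by
    calc ∑ j, A i j ≤ ∑ j, ((if i = j then (N : ℝ) else 0) + 1) :=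
          Finset.sum_le_sum fun j _ => hAle i j
      _ = N + N := by simp [Finset.sum_add_distrib, hcard]
      _ ≤ 3 * N := by linarith [(Nat.cast_nonneg N : (0 : ℝ) ≤ N)]
  have hlower (i j : S) : (wmin * χ) ^ N ≤ ℳ i j := by
    obtain ⟨p, hp⟩ := (hG.preconnected i j).exists_isPath
    rw [hℳ]
    refine Matrix.pow_le_pow_apply_of_walk hA₀ hm.le (fun i => hm₁.trans (hdiag i))
      (fun i j h => ?_) N p (hcard ▸ hp.length_lt.le)
    rw [hAadj i j h, mul_comm]
    exact mul_le_mul_of_nonneg_left (hge i j h) hχ₀.le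
  refine ⟨fun i j => (pow_pos hm N).trans_le (hlower i j), ?_⟩
  obtain ⟨i, j, k, rfl⟩ := hκ.1
  rw [div_pow]
  refine div_le_div₀ (by positivity) ?_ (pow_pos hm N) (hlower j k)
  rw [hℳ]
  exact Matrix.pow_apply_le_of_row_sum_le hA₀ hrow N i k
end

section
/- Let d = max_{i,j∈S} |E_i − E_j|, w_max = max_{(ij)∈L} w_ij, χ = e^{−βd/2}/w_max, b = 1 + max_{i∈S} Σ_{k:(ki)∈L} w_ki/w_max, ℳ = (bI + χH̄^{(0)})^N, and κ = max_{i,j,k} ℳ_ik/ℳ_jk. Then every real eigenvalue λ < 0 of M (equivalently, of H̄^{(0)}) satisfies (b + χλ)^N ≤ ((κ − 1)/(κ + 1)) · b^N. -/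
/-- If two splittings of `T` into nonnegative parts have odds ratio at most `κ ^ 2`, then their first
parts differ by at most `(κ - 1) / (κ + 1) * T`. -/
theorem sub_le_of_odds_ratio_le {a a' h h' T κ : ℝ} (ha : 0 ≤ a) (ha' : 0 ≤ a') (hh : 0 ≤ h)
    (hh' : 0 ≤ h') (hT : 0 < T) (hκ : 1 ≤ κ) (hsum : a + h = T) (hsum' : a' + h' = T)
    (hodds : a * h' ≤ κ ^ 2 * (a' * h)) : (κ + 1) * (a - a') ≤ (κ - 1) * T := by
  set s := √(a * h')
  set t := √(a' * h)
  have hs0 : 0 ≤ s := Real.sqrt_nonneg _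
  have ht0 : 0 ≤ t := Real.sqrt_nonneg _
  have hs2 : s ^ 2 = a * h' := Real.sq_sqrt (by positivity)
  have ht2 : t ^ 2 = a' * h := Real.sq_sqrt (by positivity)
  have hst : s ≤ κ * t := by
    apply le_of_sq_le_sq _ (by positivity)
    rw [mul_pow, hs2, ht2]
    exact hodds
  have hcross : 2 * (s * t) ≤ a * a' + h * h' := by
    apply le_of_sq_le_sq _ (by positivity)
    have : (2 * (s * t)) ^ 2 = 4 * ((a * h') * (a' * h)) := by rw [← hs2, ← ht2]; ring
    rw [this]
    nlinarith [sq_nonneg (a * a' - h * h')]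
  have hsum_sq : (s + t) ^ 2 ≤ T ^ 2 := by
    have hTT : T ^ 2 = (a + h) * (a' + h') := by rw [hsum, hsum', sq]
    rw [hTT, add_sq, hs2, ht2]
    linarith
  have hdiff : T * (a - a') = (s - t) * (s + t) := by
    have : (s - t) * (s + t) = a * h' - a' * h := by rw [← hs2, ← ht2]; ring
    rw [this]
    linear_combination a' * hsum - a * hsum'
  have key : (κ + 1) * ((s - t) * (s + t)) ≤ (κ - 1) * T ^ 2 := by
    have h₁ : (κ + 1) * (s - t) * (s + t) ≤ (κ - 1) * (s + t) * (s + t) :=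
      mul_le_mul_of_nonneg_right (by linarith) (by positivity)
    have h₂ : (κ - 1) * (s + t) ^ 2 ≤ (κ - 1) * T ^ 2 :=
      mul_le_mul_of_nonneg_left hsum_sq (by linarith)
    linarith
  refine le_of_mul_le_mul_left ?_ hT
  calc T * ((κ + 1) * (a - a')) = (κ + 1) * (T * (a - a')) := by ring
    _ ≤ (κ - 1) * T ^ 2 := by rw [hdiff]; exact key
    _ = T * ((κ - 1) * T) := by ring

namespace Matrix

variable {S : Type*} [Fintype S]

theorem mulVec_le_mul_mulVec_of_row_le {P : Matrix S S ℝ} {κ : ℝ}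
    (hP : ∀ i j k, P i k ≤ κ * P j k) {f : S → ℝ} (hf : ∀ k, 0 ≤ f k) (i j : S) :
    P.mulVec f i ≤ κ * P.mulVec f j := by
  simp only [mulVec, dotProduct, Finset.mul_sum]
  refine Finset.sum_le_sum fun k _ => ?_
  rw [← mul_assoc]
  exact mul_le_mul_of_nonneg_right (hP i j k) (hf k)

theorem mulVec_apply_nonneg {P : Matrix S S ℝ} (hP : ∀ i j, 0 ≤ P i j) {f : S → ℝ}
    (hf : ∀ k, 0 ≤ f k) (i : S) : 0 ≤ P.mulVec f i :=
  Finset.sum_nonneg fun k _ => mul_nonneg (hP i k) (hf k)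

/-- Hopf's bound for the real non-Perron eigenvalues of a nonnegative matrix. -/
theorem eigenvalue_le_of_row_ratio_le [Nonempty S] {P : Matrix S S ℝ} (hP : ∀ i j, 0 ≤ P i j)
    {κ : ℝ} (hκ : 1 ≤ κ) (hPκ : ∀ i j k, P i k ≤ κ * P j k) {p u : S → ℝ} {B μ : ℝ}
    (hB : 0 < B) (hp : ∀ i, 0 < p i) (hPp : P.mulVec p = B • p) (hPu : P.mulVec u = μ • u)
    (hup : ∀ c : ℝ, u ≠ c • p) : (κ + 1) * μ ≤ (κ - 1) * B := by
  obtain ⟨i, hi⟩ := Finite.exists_max fun k => u k / p k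
  obtain ⟨j, hj⟩ := Finite.exists_min fun k => u k / p k
  set X := u i / p i with hX
  set m := u j / p j with hm
  have hui : u i = X * p i := (div_mul_cancel₀ _ (hp i).ne').symm
  have huj : u j = m * p j := (div_mul_cancel₀ _ (hp j).ne').symm
  have hmX : m < X := by
    refine lt_of_le_of_ne (hj i) fun h => hup X (funext fun k => ?_)
    have : u k / p k = X := le_antisymm (hi k) (h ▸ hj k)
    rw [Pi.smul_apply, smul_eq_mul, ← this, div_mul_cancel₀ _ (hp k).ne']
  have hf : ∀ k, 0 ≤ (u - m • p) k := fun k => by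
    have := (le_div_iff₀ (hp k)).1 (hj k)
    simpa using this
  have hg : ∀ k, 0 ≤ (X • p - u) k := fun k => by
    have := (div_le_iff₀ (hp k)).1 (hi k)
    simpa using this
  have hPf : ∀ k, P.mulVec (u - m • p) k = μ * u k - m * (B * p k) := fun k => by
    simp [mulVec_sub, mulVec_smul, hPp, hPu]
  have hPg : ∀ k, P.mulVec (X • p - u) k = X * (B * p k) - μ * u k := fun k => by
    simp [mulVec_sub, mulVec_smul, hPp, hPu]
  have hfi : P.mulVec (u - m • p) i = (μ * X - m * B) * p i := by rw [hPf, hui]; ring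
  have hfj : P.mulVec (u - m • p) j = (μ * m - m * B) * p j := by rw [hPf, huj]; ring
  have hgi : P.mulVec (X • p - u) i = (X * B - μ * X) * p i := by rw [hPg, hui]; ring
  have hgj : P.mulVec (X • p - u) j = (X * B - μ * m) * p j := by rw [hPg, huj]; ring
  have hfi0 := mulVec_apply_nonneg hP hf i
  have hfj0 := mulVec_apply_nonneg hP hf j
  have hgi0 := mulVec_apply_nonneg hP hg i
  have hgj0 := mulVec_apply_nonneg hP hg j
  have hodds := mul_le_mul (mulVec_le_mul_mulVec_of_row_le hPκ hf i j)
    (mulVec_le_mul_mulVec_of_row_le hPκ hg j i) hgj0 (by positivity)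
  rw [hfi, hfj, hgi, hgj] at hodds
  rw [hfi] at hfi0
  rw [hfj] at hfj0
  rw [hgi] at hgi0
  rw [hgj] at hgj0
  have hpp : 0 < p i * p j := mul_pos (hp i) (hp j)
  have := sub_le_of_odds_ratio_le (nonneg_of_mul_nonneg_left hfi0 (hp i))
    (nonneg_of_mul_nonneg_left hfj0 (hp j)) (nonneg_of_mul_nonneg_left hgi0 (hp i))
    (nonneg_of_mul_nonneg_left hgj0 (hp j)) (mul_pos hB (sub_pos.2 hmX)) hκ (by ring) (by ring)
    (le_of_mul_le_mul_right (by linarith) hpp)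
  refine le_of_mul_le_mul_right ?_ (sub_pos.2 hmX)
  linarith

variable [DecidableEq S]

theorem pow_mulVec_of_mulVec_eq_smul {A : Matrix S S ℝ} {u : S → ℝ} {μ : ℝ}
    (h : A.mulVec u = μ • u) (n : ℕ) : (A ^ n).mulVec u = μ ^ n • u := by
  induction n with
  | zero => simp
  | succ n ih => rw [pow_succ, ← mulVec_mulVec, h, mulVec_smul, ih, smul_smul, pow_succ']

theorem pow_apply_pos_of_walk {A : Matrix S S ℝ} (hA : ∀ i j, 0 ≤ A i j) (hdiag : ∀ i, 0 < A i i)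
    {G : SimpleGraph S} (hadj : ∀ i j, G.Adj i j → 0 < A i j) (n : ℕ) {i j : S}
    (q : G.Walk i j) (hq : q.length ≤ n) : 0 < (A ^ n) i j := by
  have hpow : ∀ (n : ℕ) (i j : S), 0 ≤ (A ^ n) i j := by
    intro n
    induction n with
    | zero => intro i j; rw [pow_zero, one_apply]; split_ifs <;> norm_num
    | succ n ih =>
      intro i j
      rw [pow_succ, mul_apply]
      exact Finset.sum_nonneg fun k _ => mul_nonneg (ih i k) (hA k j)
  have step : ∀ (n : ℕ) (i k j : S), 0 < A i k → 0 < (A ^ n) k j → 0 < (A ^ (n + 1)) i j := by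
    intro n i k j h₁ h₂
    rw [pow_succ', mul_apply]
    exact Finset.sum_pos' (fun l _ => mul_nonneg (hA i l) (hpow n l j))
      ⟨k, Finset.mem_univ k, mul_pos h₁ h₂⟩
  induction n generalizing i with
  | zero =>
    obtain rfl := SimpleGraph.Walk.eq_of_length_eq_zero (Nat.le_zero.1 hq)
    simp
  | succ n ih =>
    cases q with
    | nil => exact step n j j j (hdiag j) (ih SimpleGraph.Walk.nil (by simp))
    | cons h q => exact step n i _ j (hadj _ _ h) (ih q (by simpa using hq))

end Matrix


/-- Every negative real eigenvalue `λ` of `M` satisfies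
`(b + χ λ)^N ≤ ((κ - 1)/(κ + 1)) b^N`, where
`ℳ = (b I + χ H̄⁰)^N` and `κ = max_{i,j,k} ℳ_ik / ℳ_jk`. -/
theorem negative_eigenvalue_power_bound
    {S : Type*} [Fintype S] [DecidableEq S] [Nonempty S]
    (N : ℕ) (hN : 1 ≤ N) (hcard : Fintype.card S = N)
    (E : S → ℝ) (β : ℝ) (hβ : 0 < β)
    (G : SimpleGraph S) [DecidableRel G.Adj] (hG : G.Connected)
    (w : S → S → ℝ) (hw_symm : ∀ i j, w i j = w j i)
    (hw_pos : ∀ i j, G.Adj i j → 0 < w i j)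
    (Z : ℝ) (hZ : Z = ∑ i, Real.exp (-β * E i))
    (ρ : S → ℝ) (hρ : ∀ i, ρ i = Real.exp (-β * E i) / Z)
    (M : Matrix S S ℝ)
    (hM : ∀ i j, M i j =
      if G.Adj i j then w i j * Real.exp (β * (E j - E i) / 2)
      else if i = j then
        -∑ k ∈ G.neighborFinset i, w k i * Real.exp (β * (E i - E k) / 2)
      else 0)
    (H : Matrix S S ℝ)
    (hH : ∀ i j, H i j =
      if G.Adj i j then w i j
      else if i = j then
        -∑ k ∈ G.neighborFinset i, w k i * Real.exp (β * (E i - E k) / 2)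
      else 0)
    (d : ℝ) (hd : IsGreatest {r : ℝ | ∃ i j, r = |E i - E j|} d)
    (wmax : ℝ) (hwmax : IsGreatest {r : ℝ | ∃ i j, G.Adj i j ∧ r = w i j} wmax)
    (χ : ℝ) (hχ : χ = Real.exp (-β * d / 2) / wmax)
    (b : ℝ)
    (hb : IsGreatest {r : ℝ | ∃ i, r = ∑ k ∈ G.neighborFinset i, w k i / wmax} (b - 1))
    (ℳ : Matrix S S ℝ) (hℳ : ℳ = (b • (1 : Matrix S S ℝ) + χ • H) ^ N)
    (κ : ℝ) (hκ : IsGreatest {r : ℝ | ∃ i j k, r = ℳ i k / ℳ j k} κ) :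
    ∀ lam : ℝ, lam < 0 → (∃ v : S → ℝ, v ≠ 0 ∧ M.mulVec v = lam • v) →
      (b + χ * lam) ^ N ≤ (κ - 1) / (κ + 1) * b ^ N := by
  intro lam hlam hv
  obtain ⟨v, hv0, hMv⟩ := hv
  have hwmax_pos : 0 < wmax := by
    obtain ⟨i, j, hij, h⟩ := hwmax.1
    exact h ▸ hw_pos i j hij
  have hχ_pos : 0 < χ := hχ ▸ by positivity
  have hw_nonneg : ∀ i, ∀ k ∈ G.neighborFinset i, 0 ≤ w k i := fun i k hk =>
    (hw_pos k i ((G.mem_neighborFinset i k).1 hk).symm).le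
  have hb_one : 1 ≤ b := by
    obtain ⟨i, h⟩ := hb.1
    have : 0 ≤ ∑ k ∈ G.neighborFinset i, w k i / wmax :=
      Finset.sum_nonneg fun k hk => div_nonneg (hw_nonneg i k hk) hwmax_pos.le
    linarith
  have hχ_le : ∀ i k, χ * Real.exp (β * (E i - E k) / 2) ≤ 1 / wmax := fun i k => by
    rw [hχ, div_mul_eq_mul_div, ← Real.exp_add]
    refine div_le_div_of_nonneg_right (Real.exp_le_one_iff.2 ?_) hwmax_pos.le
    have : E i - E k ≤ d := (le_abs_self _).trans (hd.2 ⟨i, k, rfl⟩)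
    nlinarith
  set A : Matrix S S ℝ := b • (1 : Matrix S S ℝ) + χ • H with hA
  have hA_adj : ∀ i j, G.Adj i j → 0 < A i j := fun i j hij => by
    simp only [hA, Matrix.add_apply, Matrix.smul_apply, Matrix.one_apply_ne hij.ne, hH, if_pos hij,
      smul_eq_mul, mul_zero, zero_add]
    exact mul_pos hχ_pos (hw_pos i j hij)
  have hA_diag : ∀ i, 0 < A i i := fun i => by
    have hle : χ * ∑ k ∈ G.neighborFinset i, w k i * Real.exp (β * (E i - E k) / 2) ≤ b - 1 := by
      refine le_trans ?_ (hb.2 ⟨i, rfl⟩)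
      rw [Finset.mul_sum]
      refine Finset.sum_le_sum fun k hk => ?_
      have := mul_le_mul_of_nonneg_left (hχ_le i k) (hw_nonneg i k hk)
      rw [mul_one_div] at this
      linarith
    simp only [hA, Matrix.add_apply, Matrix.smul_apply, Matrix.one_apply_eq, hH, G.irrefl, if_false,
      if_true, smul_eq_mul, mul_one, mul_neg]
    linarith
  have hA_nonneg : ∀ i j, 0 ≤ A i j := fun i j => by
    by_cases hij : i = j
    · exact hij ▸ (hA_diag i).le
    by_cases hadj : G.Adj i j
    · exact (hA_adj i j hadj).le
    · simp [hA, hH, hij, hadj]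
  have hℳ_pos : ∀ i j, 0 < ℳ i j := fun i j => by
    obtain ⟨q, hq⟩ := (hG.preconnected i j).exists_isPath
    exact hℳ ▸ Matrix.pow_apply_pos_of_walk hA_nonneg hA_diag hA_adj N q (hcard ▸ hq.length_lt.le)
  have hκ_one : 1 ≤ κ := by
    obtain ⟨i⟩ := ‹Nonempty S›
    exact hκ.2 ⟨i, i, i, (div_self (hℳ_pos i i).ne').symm⟩
  have hℳκ : ∀ i j k, ℳ i k ≤ κ * ℳ j k := fun i j k =>
    (div_le_iff₀ (hℳ_pos j k)).1 (hκ.2 ⟨i, j, k, rfl⟩)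
  have hHM : ∀ i j, H i j * Real.exp (β * E j / 2) = Real.exp (β * E i / 2) * M i j := fun i j => by
    rw [hH, hM]
    split_ifs with h₁ h₂
    · rw [mul_left_comm, ← Real.exp_add]
      ring_nf
    · rw [h₂, mul_comm]
    · simp
  have hHp : H.mulVec (fun i => Real.exp (-(β * E i / 2))) = 0 := by
    funext i
    have hsplit : ∀ j, H i j * Real.exp (-(β * E j / 2)) =
        (if G.Adj i j then w i j * Real.exp (-(β * E j / 2)) else 0) +
        if i = j then -∑ k ∈ G.neighborFinset i,
          w k i * Real.exp (β * (E i - E k) / 2) * Real.exp (-(β * E i / 2)) else 0 := fun j => by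
      rw [hH]
      split_ifs with h₁ h₂ h₂
      · exact absurd h₂ h₁.ne
      · rw [add_zero]
      · rw [zero_add, ← h₂, neg_mul, Finset.sum_mul]
      · simp
    simp only [Matrix.mulVec, dotProduct, hsplit, Finset.sum_add_distrib, Finset.sum_ite_eq,
      Finset.mem_univ, if_true, Pi.zero_apply, ← Finset.sum_filter,
      ← SimpleGraph.neighborFinset_eq_filter]
    rw [← sub_eq_add_neg, sub_eq_zero]
    refine Finset.sum_congr rfl fun k _ => ?_
    rw [hw_symm i k, mul_assoc, ← Real.exp_add]
    ring_nf
  set u : S → ℝ := fun i => Real.exp (β * E i / 2) * v i with hu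
  have hHu : H.mulVec u = lam • u := by
    funext i
    have h := congrFun hMv i
    simp only [Matrix.mulVec, dotProduct, Pi.smul_apply, smul_eq_mul] at h ⊢
    simp only [hu, ← mul_assoc, hHM]
    simp only [mul_assoc, ← Finset.mul_sum, h]
    ring
  have hu0 : u ≠ 0 := fun h => hv0 <| funext fun i => by
    simpa [hu, Real.exp_ne_zero] using congrFun h i
  have hA_mulVec : ∀ x : S → ℝ, A.mulVec x = b • x + χ • H.mulVec x := fun x => by
    simp [hA, Matrix.add_mulVec, Matrix.smul_mulVec]
  have hbound := Matrix.eigenvalue_le_of_row_ratio_le (fun i j => (hℳ_pos i j).le) hκ_one hℳκ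
    (pow_pos (zero_lt_one.trans_le hb_one) N) (fun i => Real.exp_pos (-(β * E i / 2)))
    (hℳ ▸ Matrix.pow_mulVec_of_mulVec_eq_smul (by rw [hA_mulVec, hHp, smul_zero, add_zero]) N)
    (hℳ ▸ Matrix.pow_mulVec_of_mulVec_eq_smul (u := u) (μ := b + χ * lam)
      (by rw [hA_mulVec, hHu, smul_smul, add_smul]) N)
    (fun c hc => hu0 <| by
      have : lam • u = 0 := by rw [← hHu, hc, Matrix.mulVec_smul, hHp, smul_zero]
      exact (smul_eq_zero.1 this).resolve_left hlam.ne)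
  rw [div_mul_eq_mul_div, le_div_iff₀ (by linarith)]
  linarith
end

section
/- Let d = max_{i,j∈S} |E_i − E_j|, w_max = max_{(ij)∈L} w_ij, χ = e^{−βd/2}/w_max, b = 1 + max_{i∈S} Σ_{k:(ki)∈L} w_ki/w_max, ℳ = (bI + χH̄^{(0)})^N, and κ = max_{i,j,k} ℳ_ik/ℳ_jk. Then every real eigenvalue λ < 0 of M satisfies χλ ≤ −2b/(N(κ + 1)). -/
open Finset in
/-- Real form of Hopf's bound: if the rows of a nonnegative matrix are comparable up to a factor
`κ`, then a real eigenvalue `μ` below the eigenvalue `θ` of a positive eigenvector satisfies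
`θ + μ ≤ κ (θ - μ)`. -/
theorem Matrix.add_le_mul_sub_of_row_ratio_le {S : Type*} [Fintype S] [Nonempty S]
    {P : Matrix S S ℝ} {κ θ μ : ℝ} {x u : S → ℝ}
    (hP : ∀ i j, 0 ≤ P i j) (hκ : 1 ≤ κ) (hratio : ∀ i j k, P i k ≤ κ * P j k)
    (hx : ∀ i, 0 < x i) (hPx : P.mulVec x = θ • x) (hPu : P.mulVec u = μ • u)
    (hu : u ≠ 0) (hμ : μ < θ) : θ + μ ≤ κ * (θ - μ) := by
  have hκ0 : 0 ≤ κ := zero_le_one.trans hκ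
  obtain ⟨i, hi⟩ := Finite.exists_max fun k => u k / x k
  obtain ⟨j, hj⟩ := Finite.exists_min fun k => u k / x k
  set F := u i / x i with hF
  set m := u j / x j with hm
  have hui : u i = F * x i := by rw [hF, div_mul_cancel₀ _ (hx i).ne']
  have huj : u j = m * x j := by rw [hm, div_mul_cancel₀ _ (hx j).ne']
  have hy : ∀ k, 0 ≤ F * x k - u k := fun k => by
    have := (div_le_iff₀ (hx k)).1 (hi k)
    linarith
  have hz : ∀ k, 0 ≤ u k - m * x k := fun k => by
    have := (le_div_iff₀ (hx k)).1 (hj k)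
    linarith
  have hmF : m < F := by
    refine lt_of_le_of_ne (hi j) fun h => hu ?_
    have hueq : u = F • x := by
      ext k
      have h1 := hy k
      have h2 := hz k
      rw [h] at h2
      simp only [Pi.smul_apply, smul_eq_mul]
      linarith
    have h1 : P.mulVec u = θ • u := by
      rw [hueq, Matrix.mulVec_smul, hPx, smul_comm]
    have h2 : (θ - μ) • u = 0 := by rw [sub_smul, ← h1, hPu, sub_self]
    exact (smul_eq_zero.1 h2).resolve_left (sub_pos.2 hμ).ne'
  have hPx' : ∀ r, ∑ k, P r k * x k = θ * x r := fun r => congrFun hPx r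
  have hPu' : ∀ r, ∑ k, P r k * u k = μ * u r := fun r => congrFun hPu r
  have hPy : ∀ r, ∑ k, P r k * (F * x k - u k) = F * (θ * x r) - μ * u r := fun r => by
    rw [← hPx', ← hPu', mul_sum, ← sum_sub_distrib]
    exact sum_congr rfl fun k _ => by ring
  have hPz : ∀ r, ∑ k, P r k * (u k - m * x k) = μ * u r - m * (θ * x r) := fun r => by
    rw [← hPx', ← hPu', mul_sum, ← sum_sub_distrib]
    exact sum_congr rfl fun k _ => by ring
  have hcross : (∑ k, P i k * (u k - m * x k)) * (∑ l, P j l * (F * x l - u l)) ≤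
      (κ * ∑ k, P j k * (u k - m * x k)) * (κ * ∑ l, P i l * (F * x l - u l)) := by
    have hle : ∀ (r s : S) (y : S → ℝ), (∀ k, 0 ≤ y k) →
        ∑ k, P r k * y k ≤ κ * ∑ k, P s k * y k := fun r s y h => by
      rw [mul_sum]
      refine sum_le_sum fun k _ => ?_
      rw [← mul_assoc]
      exact mul_le_mul_of_nonneg_right (hratio r s k) (h k)
    exact mul_le_mul (hle i j _ hz) (hle j i _ hy)
      (sum_nonneg fun k _ => mul_nonneg (hP j k) (hy k))
      (mul_nonneg hκ0 (sum_nonneg fun k _ => mul_nonneg (hP j k) (hz k)))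
  rw [hPz, hPz, hPy, hPy, hui, huj] at hcross
  have hxx : 0 < x i * x j := mul_pos (hx i) (hx j)
  have hscaled : (μ * F - m * θ) * (F * θ - μ * m) ≤ κ ^ 2 * (-(m * F) * (θ - μ) ^ 2) := by
    refine le_of_mul_le_mul_right ?_ hxx
    linarith
  have hmul : (F - m) ^ 2 * (θ + μ) ^ 2 ≤ (F - m) ^ 2 * (κ * (θ - μ)) ^ 2 := by
    have h1 : 0 ≤ (κ ^ 2 - 1) * ((F + m) ^ 2 * (θ - μ) ^ 2) :=
      mul_nonneg (by nlinarith) (by positivity)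
    linarith
  have hsq : (θ + μ) ^ 2 ≤ (κ * (θ - μ)) ^ 2 :=
    le_of_mul_le_mul_left hmul (pow_pos (sub_pos.2 hmF) 2)
  exact le_of_sq_le_sq hsq (mul_nonneg hκ0 (sub_pos.2 hμ).le)

/-- If a nonnegative matrix is positive on the diagonal and on the edges of a graph, then its
`n`-th power is positive at the endpoints of every walk of length at most `n`. -/
theorem Matrix.pow_apply_pos_of_walk_s14 {S : Type*} [Fintype S] [DecidableEq S]
    {G : SimpleGraph S} {A : Matrix S S ℝ} (hA : ∀ i j, 0 ≤ A i j) (hdiag : ∀ i, 0 < A i i)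
    (hadj : ∀ i j, G.Adj i j → 0 < A i j) (n : ℕ) {i j : S} (p : G.Walk i j)
    (hp : p.length ≤ n) : 0 < (A ^ n) i j := by
  induction n generalizing i j with
  | zero =>
    obtain rfl := p.eq_of_length_eq_zero (Nat.le_zero.1 hp)
    simp
  | succ n ih =>
    have hpow : ∀ k l, 0 ≤ (A ^ n) k l := by
      clear ih hp p
      induction n with
      | zero =>
        intro k l
        rw [pow_zero, Matrix.one_apply]
        split_ifs <;> norm_num
      | succ n ih =>
        intro k l
        rw [pow_succ, Matrix.mul_apply]
        exact Finset.sum_nonneg fun r _ => mul_nonneg (ih k r) (hA r l)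
    rw [pow_succ', Matrix.mul_apply]
    have key : ∀ k, 0 < A i k → 0 < (A ^ n) k j → 0 < ∑ r, A i r * (A ^ n) r j :=
      fun k h1 h2 => Finset.sum_pos' (fun r _ => mul_nonneg (hA i r) (hpow r j))
        ⟨k, Finset.mem_univ k, mul_pos h1 h2⟩
    cases p with
    | nil => exact key i (hdiag i) (ih .nil (by simp))
    | cons h q =>
      exact key _ (hadj _ _ h) (ih q (by simpa using hp))

/-- An eigenvector of `A` is an eigenvector of every power of `A`. -/
theorem Matrix.pow_mulVec_eq_smul {S : Type*} [Fintype S] [DecidableEq S]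
    {A : Matrix S S ℝ} {a : ℝ} {x : S → ℝ} (h : A.mulVec x = a • x) (n : ℕ) :
    (A ^ n).mulVec x = a ^ n • x := by
  induction n with
  | zero => simp
  | succ n ih =>
    rw [pow_succ, ← Matrix.mulVec_mulVec, h, Matrix.mulVec_smul, ih, smul_smul, pow_succ']

/-- Every negative real eigenvalue `λ` of `M` satisfies
`χ λ ≤ -2b/(N(κ + 1))`, where `ℳ = (b I + χ H̄⁰)^N` and
`κ = max_{i,j,k} ℳ_ik / ℳ_jk`. -/
theorem negative_eigenvalue_bound
    {S : Type*} [Fintype S] [DecidableEq S] [Nonempty S]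
    (N : ℕ) (hN : 1 ≤ N) (hcard : Fintype.card S = N)
    (E : S → ℝ) (β : ℝ) (hβ : 0 < β)
    (G : SimpleGraph S) [DecidableRel G.Adj] (hG : G.Connected)
    (w : S → S → ℝ) (hw_symm : ∀ i j, w i j = w j i)
    (hw_pos : ∀ i j, G.Adj i j → 0 < w i j)
    (Z : ℝ) (hZ : Z = ∑ i, Real.exp (-β * E i))
    (ρ : S → ℝ) (hρ : ∀ i, ρ i = Real.exp (-β * E i) / Z)
    (M : Matrix S S ℝ)
    (hM : ∀ i j, M i j =
      if G.Adj i j then w i j * Real.exp (β * (E j - E i) / 2)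
      else if i = j then
        -∑ k ∈ G.neighborFinset i, w k i * Real.exp (β * (E i - E k) / 2)
      else 0)
    (H : Matrix S S ℝ)
    (hH : ∀ i j, H i j =
      if G.Adj i j then w i j
      else if i = j then
        -∑ k ∈ G.neighborFinset i, w k i * Real.exp (β * (E i - E k) / 2)
      else 0)
    (d : ℝ) (hd : IsGreatest {r : ℝ | ∃ i j, r = |E i - E j|} d)
    (wmax : ℝ) (hwmax : IsGreatest {r : ℝ | ∃ i j, G.Adj i j ∧ r = w i j} wmax)
    (χ : ℝ) (hχ : χ = Real.exp (-β * d / 2) / wmax)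
    (b : ℝ)
    (hb : IsGreatest {r : ℝ | ∃ i, r = ∑ k ∈ G.neighborFinset i, w k i / wmax} (b - 1))
    (ℳ : Matrix S S ℝ) (hℳ : ℳ = (b • (1 : Matrix S S ℝ) + χ • H) ^ N)
    (κ : ℝ) (hκ : IsGreatest {r : ℝ | ∃ i j k, r = ℳ i k / ℳ j k} κ) :
    ∀ lam : ℝ, lam < 0 → (∃ v : S → ℝ, v ≠ 0 ∧ M.mulVec v = lam • v) →
      χ * lam ≤ -(2 * b) / (N * (κ + 1)) := by
  classical
  rintro lam hlam ⟨v, hv, hMv⟩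
  have hwm : 0 < wmax := by
    obtain ⟨⟨i, j, hij, rfl⟩, -⟩ := hwmax
    exact hw_pos i j hij
  have hχ0 : 0 < χ := by rw [hχ]; positivity
  have hχw : ∀ i k, χ * Real.exp (β * (E i - E k) / 2) ≤ 1 / wmax := fun i k => by
    have h1 : E i - E k ≤ d := (le_abs_self _).trans (hd.2 ⟨i, k, rfl⟩)
    rw [hχ, div_mul_eq_mul_div, ← Real.exp_add]
    refine div_le_div_of_nonneg_right (Real.exp_le_one_iff.2 ?_) hwm.le
    nlinarith
  set A : Matrix S S ℝ := b • (1 : Matrix S S ℝ) + χ • H with hA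
  have hAoff : ∀ i j, i ≠ j → A i j = χ * H i j := fun i j hij => by
    simp [hA, Matrix.one_apply_ne hij]
  have hAdiag : ∀ i, 0 < A i i := fun i => by
    have h1 : A i i = b + χ * H i i := by simp [hA]
    have h2 : ∑ k ∈ G.neighborFinset i, w k i / wmax ≤ b - 1 := hb.2 ⟨i, rfl⟩
    have h3 : χ * ∑ k ∈ G.neighborFinset i, w k i * Real.exp (β * (E i - E k) / 2) ≤
        ∑ k ∈ G.neighborFinset i, w k i / wmax := by
      rw [Finset.mul_sum]
      refine Finset.sum_le_sum fun k hk => ?_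
      have hadj : G.Adj k i := ((G.mem_neighborFinset i k).1 hk).symm
      have := mul_le_mul_of_nonneg_left (hχw i k) (hw_pos k i hadj).le
      calc _ = w k i * (χ * Real.exp (β * (E i - E k) / 2)) := by ring
        _ ≤ _ := this
        _ = _ := by ring
    rw [h1, hH, if_neg (G.irrefl), if_pos rfl]
    linarith
  have hAadj : ∀ i j, G.Adj i j → 0 < A i j := fun i j hij => by
    rw [hAoff i j hij.ne, hH, if_pos hij]
    exact mul_pos hχ0 (hw_pos i j hij)
  have hA0 : ∀ i j, 0 ≤ A i j := fun i j => by
    by_cases hij : i = j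
    · subst hij
      exact (hAdiag i).le
    by_cases hadj : G.Adj i j
    · exact (hAadj i j hadj).le
    · rw [hAoff i j hij, hH, if_neg hadj, if_neg hij, mul_zero]
  have hpos : ∀ i j, 0 < ℳ i j := fun i j => by
    obtain ⟨p⟩ := hG.preconnected i j
    rw [hℳ]
    refine Matrix.pow_apply_pos_of_walk_s14 hA0 hAdiag hAadj N p.bypass ?_
    rw [← hcard]
    exact p.bypass_isPath.length_lt.le
  have hratio : ∀ i j k, ℳ i k ≤ κ * ℳ j k := fun i j k =>
    (div_le_iff₀ (hpos j k)).1 (hκ.2 ⟨i, j, k, rfl⟩)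
  have hκ1 : 1 ≤ κ := by
    obtain ⟨i⟩ := ‹Nonempty S›
    exact hκ.2 ⟨i, i, i, (div_self (hpos i i).ne').symm⟩
  have hb1 : 1 ≤ b := by
    obtain ⟨⟨i, hi⟩, -⟩ := hb
    have : 0 ≤ b - 1 := by
      rw [hi]
      refine Finset.sum_nonneg fun k hk => div_nonneg (hw_pos k i ?_).le hwm.le
      exact ((G.mem_neighborFinset i k).1 hk).symm
    linarith
  set x : S → ℝ := fun i => Real.exp (-β * E i / 2) with hx
  have hx0 : ∀ i, 0 < x i := fun i => Real.exp_pos _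
  have hAmul : ∀ (y : S → ℝ) (a : ℝ), H.mulVec y = a • y → A.mulVec y = (b + χ * a) • y :=
    fun y a h => by
      rw [hA, Matrix.add_mulVec, Matrix.smul_mulVec, Matrix.smul_mulVec, Matrix.one_mulVec, h,
        smul_smul, add_smul]
  have hHx : H.mulVec x = (0 : ℝ) • x := by
    ext i
    have hsplit : ∀ j, H i j * x j = (if G.Adj i j then w i j * x j else 0) +
        if i = j then H i i * x i else 0 := fun j => by
      by_cases hij : i = j
      · subst hij
        simp
      · by_cases hadj : G.Adj i j <;> simp [hH i j, hij, hadj]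
    rw [Matrix.mulVec, dotProduct, Finset.sum_congr rfl fun j _ => hsplit j]
    simp only [Finset.sum_add_distrib, Finset.sum_ite_eq, Finset.mem_univ, if_true,
      Pi.smul_apply, zero_smul]
    rw [hH, if_neg G.irrefl, if_pos rfl, neg_mul, Finset.sum_mul, ← Finset.sum_filter,
      ← SimpleGraph.neighborFinset_eq_filter, ← sub_eq_add_neg, sub_eq_zero]
    refine Finset.sum_congr rfl fun k _ => ?_
    rw [hw_symm k i, mul_assoc, hx, ← Real.exp_add]
    ring_nf
  have hMH : ∀ i j, M i j = x i * H i j / x j := fun i j => by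
    rw [hM, hH]
    split_ifs with h1 h2
    · rw [eq_div_iff (hx0 j).ne', mul_assoc, hx, ← Real.exp_add, mul_comm (Real.exp _)]
      ring_nf
    · subst h2
      rw [mul_div_assoc, mul_comm, div_mul_cancel₀ _ (hx0 i).ne']
    · simp
  set u : S → ℝ := fun i => v i / x i with hu
  have hu0 : u ≠ 0 := fun h => hv <| by
    ext i
    have := congrFun h i
    simpa [hu, (hx0 i).ne'] using this
  have hHu : H.mulVec u = lam • u := by
    ext i
    have h1 : ∑ j, M i j * v j = lam * v i := congrFun hMv i
    change ∑ j, H i j * (v j / x j) = lam * (v i / x i)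
    rw [← mul_div_assoc, ← h1, eq_div_iff (hx0 i).ne', Finset.sum_mul]
    refine Finset.sum_congr rfl fun j _ => ?_
    rw [hMH]
    ring
  have hN0 : (1 : ℝ) ≤ N := by exact_mod_cast hN
  have hden : 0 < (N : ℝ) * (κ + 1) := by positivity
  have hχlam : χ * lam < 0 := mul_neg_of_pos_of_neg hχ0 hlam
  rw [le_div_iff₀ hden]
  rcases lt_or_ge (b + χ * lam) 0 with hneg | hnn
  · have h2 : 2 ≤ (N : ℝ) * (κ + 1) := by nlinarith
    nlinarith
  have hb0 : 0 < b := by linarith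
  have hlt : (b + χ * lam) ^ N < b ^ N :=
    pow_lt_pow_left₀ (by linarith) hnn (by omega)
  have hopf := Matrix.add_le_mul_sub_of_row_ratio_le (fun i j => (hpos i j).le)
    hκ1 hratio hx0
    (by rw [hℳ]; exact Matrix.pow_mulVec_eq_smul (by simpa using hAmul x 0 hHx) N)
    (by rw [hℳ]; exact Matrix.pow_mulVec_eq_smul (hAmul u lam hHu) N) hu0 hlt
  set t := χ * lam / b with ht
  have htb : b + χ * lam = b * (1 + t) := by rw [ht]; field_simp
  have ht1 : -2 ≤ t := by nlinarith
  have hbern := one_add_mul_le_pow ht1 N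
  rw [htb, mul_pow] at hopf
  have hbN : 0 < b ^ N := pow_pos hb0 N
  have hpow : (1 + t) ^ N * (κ + 1) ≤ κ - 1 := by
    refine le_of_mul_le_mul_left ?_ hbN
    linarith
  have hfin : (1 + N * t) * (κ + 1) ≤ κ - 1 :=
    (mul_le_mul_of_nonneg_right hbern (by linarith)).trans hpow
  have hχt : χ * lam = b * t := by linarith
  rw [hχt]
  nlinarith
end

section
/- Let d = max_{i,j∈S} |E_i − E_j|, w_max = max_{(ij)∈L} w_ij, w_min = min_{(ij)∈L} w_ij, χ = e^{−βd/2}/w_max, b = 1 + max_{i∈S} Σ_{k:(ki)∈L} w_ki/w_max, and δ = b/(N(3N)^N). Suppose d' ≥ 0 is such that w_min/w_max ≥ e^{−βd'/2}. Then every real eigenvalue λ < 0 of M satisfies χλ ≤ −δ e^{−βN(d+d')/2}. -/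
/-- A function varying by at most `ε` along edges of a connected graph varies by at most
`card S * ε` overall. -/
lemma SimpleGraph.Connected.abs_sub_le_card_mul {S : Type*} [Fintype S] {G : SimpleGraph S}
    (hG : G.Connected) {u : S → ℝ} {ε : ℝ} (hε : 0 ≤ ε)
    (h : ∀ i j, G.Adj i j → |u i - u j| ≤ ε) (i j : S) :
    |u i - u j| ≤ Fintype.card S * ε := by
  classical
  obtain ⟨p, hp⟩ := (hG.preconnected i j).exists_isPath
  have key : ∀ {a b : S} (q : G.Walk a b), |u a - u b| ≤ q.length * ε := by
    intro a b q
    induction q with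
    | nil => simp
    | @cons a b c hab q ih =>
      have h₁ := abs_sub_le (u a) (u b) (u c)
      have h₂ := h _ _ hab
      rw [SimpleGraph.Walk.length_cons]
      push_cast
      linarith
  refine (key p).trans (mul_le_mul_of_nonneg_right ?_ hε)
  exact_mod_cast hp.length_lt.le

/-- Lower bound on the modulus of a negative eigenvalue of a weighted graph Laplacian with
vertex weights `p` and edge conductances `c`. -/
lemma le_neg_eigenvalue_of_conductance {S : Type*} [Fintype S] {G : SimpleGraph S}
    (hG : G.Connected) {c : S → S → ℝ} (hc_symm : ∀ i j, c i j = c j i)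
    (hc_nonneg : ∀ i j, 0 ≤ c i j) {κ : ℝ} (hκ : 0 < κ) (hc : ∀ i j, G.Adj i j → κ ≤ c i j)
    {p : S → ℝ} (hp : ∀ i, 0 < p i) {P : ℝ} (hP : ∀ i, p i ≤ P)
    {u : S → ℝ} (hu : u ≠ 0) {lam : ℝ} (hlam : lam < 0)
    (h : ∀ i, ∑ j, c i j * (u j - u i) = lam * (p i * u i)) :
    κ ≤ 2 * (Fintype.card S : ℝ) ^ 3 * P * (-lam) := by
  classical
  have : Nonempty S := hG.nonempty
  have hswap : ∀ f : S → S → ℝ, ∑ i, ∑ j, f i j = ∑ i, ∑ j, f j i := fun f =>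
    Finset.sum_comm
  have hmean : ∑ i, p i * u i = 0 := by
    have h₁ : ∑ i, ∑ j, c i j * (u j - u i) = lam * ∑ i, p i * u i := by
      rw [Finset.mul_sum]
      exact Finset.sum_congr rfl fun i _ => h i
    have h₂ : ∑ i, ∑ j, c i j * (u j - u i) = -∑ i, ∑ j, c i j * (u j - u i) := by
      conv_lhs => rw [hswap]
      simp only [← Finset.sum_neg_distrib]
      refine Finset.sum_congr rfl fun i _ => Finset.sum_congr rfl fun j _ => ?_
      rw [hc_symm j i]; ring
    have h₃ : lam * ∑ i, p i * u i = 0 := by linarith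
    exact (mul_eq_zero.mp h₃).resolve_left hlam.ne
  have henergy : ∑ i, ∑ j, c i j * (u j - u i) ^ 2 = 2 * (-lam) * ∑ i, p i * u i ^ 2 := by
    have h₁ : ∑ i, ∑ j, u i * (c i j * (u j - u i)) = lam * ∑ i, p i * u i ^ 2 := by
      rw [Finset.mul_sum]
      refine Finset.sum_congr rfl fun i _ => ?_
      rw [← Finset.mul_sum, h i]; ring
    have h₂ : ∑ i, ∑ j, u j * (c i j * (u j - u i)) = -(lam * ∑ i, p i * u i ^ 2) := by
      rw [← h₁, hswap]
      simp only [← Finset.sum_neg_distrib]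
      refine Finset.sum_congr rfl fun i _ => Finset.sum_congr rfl fun j _ => ?_
      rw [hc_symm j i]; ring
    calc ∑ i, ∑ j, c i j * (u j - u i) ^ 2
        = ∑ i, ∑ j, (u j * (c i j * (u j - u i)) - u i * (c i j * (u j - u i))) :=
          Finset.sum_congr rfl fun i _ => Finset.sum_congr rfl fun j _ => by ring
      _ = 2 * (-lam) * ∑ i, p i * u i ^ 2 := by
          simp only [Finset.sum_sub_distrib]
          rw [h₁, h₂]; ring
  obtain ⟨a, ha⟩ := Finite.exists_max fun i => u i ^ 2
  have hua : 0 < u a ^ 2 := by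
    obtain ⟨i, hi⟩ := Function.ne_iff.mp hu
    exact (sq_pos_of_ne_zero hi).trans_le (ha i)
  obtain ⟨b, hb⟩ : ∃ b, u a * u b ≤ 0 := by
    by_contra! hcon
    have h₁ : 0 < ∑ i, p i * (u a * u i) :=
      Finset.sum_pos (fun i _ => mul_pos (hp i) (hcon i)) Finset.univ_nonempty
    have h₂ : ∑ i, p i * (u a * u i) = u a * ∑ i, p i * u i := by
      rw [Finset.mul_sum]
      exact Finset.sum_congr rfl fun i _ => by ring
    rw [h₂, hmean, mul_zero] at h₁
    exact h₁.false
  have hmass : ∑ i, p i * u i ^ 2 ≤ Fintype.card S * (P * u a ^ 2) := by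
    calc ∑ i, p i * u i ^ 2 ≤ ∑ _i : S, P * u a ^ 2 :=
          Finset.sum_le_sum fun i _ =>
            mul_le_mul (hP i) (ha i) (sq_nonneg _) ((hp i).le.trans (hP i))
      _ = Fintype.card S * (P * u a ^ 2) := by simp
  have hP₀ : 0 < P := (hp a).trans_le (hP a)
  set n := (Fintype.card S : ℝ)
  have hn₀ : 0 ≤ n := Nat.cast_nonneg _
  set D := 2 * (-lam) * (n * (P * u a ^ 2)) with hD
  have hedge : ∀ i j, G.Adj i j → |u i - u j| ≤ √(D / κ) := by
    intro i j hij
    refine Real.abs_le_sqrt ((le_div_iff₀ hκ).mpr ?_)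
    have hnn : ∀ i j, 0 ≤ c i j * (u j - u i) ^ 2 := fun i j =>
      mul_nonneg (hc_nonneg i j) (sq_nonneg _)
    calc (u i - u j) ^ 2 * κ ≤ c i j * (u j - u i) ^ 2 := by
          nlinarith [mul_le_mul_of_nonneg_right (hc i j hij) (sq_nonneg (u j - u i))]
      _ ≤ ∑ j, c i j * (u j - u i) ^ 2 :=
          Finset.single_le_sum (f := fun j => c i j * (u j - u i) ^ 2)
            (fun j _ => hnn i j) (Finset.mem_univ j)
      _ ≤ ∑ i, ∑ j, c i j * (u j - u i) ^ 2 :=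
          Finset.single_le_sum (f := fun i => ∑ j, c i j * (u j - u i) ^ 2)
            (fun i _ => Finset.sum_nonneg fun j _ => hnn i j) (Finset.mem_univ i)
      _ ≤ D := by
          rw [henergy]
          exact mul_le_mul_of_nonneg_left hmass (by linarith)
  have hab := hG.abs_sub_le_card_mul (Real.sqrt_nonneg _) hedge a b
  have hD₀ : 0 ≤ D / κ := by
    have : 0 ≤ -lam := by linarith
    positivity
  have h₁ : (u a - u b) ^ 2 ≤ n ^ 2 * (D / κ) := by
    rw [← sq_abs, ← Real.sq_sqrt hD₀, ← mul_pow]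
    exact pow_le_pow_left₀ (abs_nonneg _) hab 2
  have h₂ : u a ^ 2 ≤ n ^ 2 * (D / κ) := by nlinarith [sq_nonneg (u b)]
  rw [← mul_div_assoc, le_div_iff₀ hκ] at h₂
  refine le_of_mul_le_mul_left (h₂.trans_eq ?_) hua
  rw [hD]; ring

/-- Symmetrised form of the eigenvalue equation for the rate matrix. -/
lemma sum_conductance_mul_sub_eq {S : Type*} [Fintype S] [DecidableEq S]
    {E : S → ℝ} {β : ℝ} {G : SimpleGraph S} [DecidableRel G.Adj]
    {w : S → S → ℝ} (hw_symm : ∀ i j, w i j = w j i) {M : Matrix S S ℝ}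
    (hM : ∀ i j, M i j =
      if G.Adj i j then w i j * Real.exp (β * (E j - E i) / 2)
      else if i = j then
        -∑ k ∈ G.neighborFinset i, w k i * Real.exp (β * (E i - E k) / 2)
      else 0)
    {lam : ℝ} {v : S → ℝ} (hv : M.mulVec v = lam • v) (i : S) :
    ∑ j, (if G.Adj i j then w i j * Real.exp (-β * (E i + E j) / 2) else 0) *
        (Real.exp (β * E j) * v j - Real.exp (β * E i) * v i) =
      lam * (Real.exp (-β * E i) * (Real.exp (β * E i) * v i)) := by
  have hvi : ∑ j, M i j * v j = lam * v i := congrFun hv i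
  have hrhs : Real.exp (-β * E i) * (Real.exp (β * E i) * v i) = v i := by
    rw [← mul_assoc, ← Real.exp_add]; simp
  rw [hrhs, ← hvi]
  have hsplit : ∀ j, M i j * v j =
      (if G.Adj i j then w i j * Real.exp (β * (E j - E i) / 2) * v j else 0) +
      (if i = j then
        -(∑ k, if G.Adj i k then w k i * Real.exp (β * (E i - E k) / 2) else 0) * v j
        else 0) := by
    intro j
    rw [hM, G.neighborFinset_eq_filter, Finset.sum_filter]
    by_cases hij : i = j
    · subst hij; simp
    · simp [hij]
  simp only [hsplit, Finset.sum_add_distrib, Finset.sum_ite_eq, Finset.mem_univ, if_true]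
  rw [neg_mul, Finset.sum_mul, ← sub_eq_add_neg, ← Finset.sum_sub_distrib]
  refine Finset.sum_congr rfl fun j _ => ?_
  split_ifs
  · have h₁ : Real.exp (-β * (E i + E j) / 2) * Real.exp (β * E j) =
        Real.exp (β * (E j - E i) / 2) := by rw [← Real.exp_add]; ring_nf
    have h₂ : Real.exp (-β * (E i + E j) / 2) * Real.exp (β * E i) =
        Real.exp (β * (E i - E j) / 2) := by rw [← Real.exp_add]; ring_nf
    rw [← h₁, ← h₂, hw_symm j i]; ring
  · simp


/-- With `δ = b/(N (3N)^N)` and `w_min/w_max ≥ e^{-β d′/2}`, `d′ ≥ 0`, every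
negative real eigenvalue `λ` of `M` satisfies `χ λ ≤ -δ e^{-β N (d + d′)/2}`. -/
theorem negative_eigenvalue_exponential_bound
    {S : Type*} [Fintype S] [DecidableEq S] [Nonempty S]
    (N : ℕ) (hN : 1 ≤ N) (hcard : Fintype.card S = N)
    (E : S → ℝ) (β : ℝ) (hβ : 0 < β)
    (G : SimpleGraph S) [DecidableRel G.Adj] (hG : G.Connected)
    (w : S → S → ℝ) (hw_symm : ∀ i j, w i j = w j i)
    (hw_pos : ∀ i j, G.Adj i j → 0 < w i j)
    (Z : ℝ) (hZ : Z = ∑ i, Real.exp (-β * E i))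
    (ρ : S → ℝ) (hρ : ∀ i, ρ i = Real.exp (-β * E i) / Z)
    (M : Matrix S S ℝ)
    (hM : ∀ i j, M i j =
      if G.Adj i j then w i j * Real.exp (β * (E j - E i) / 2)
      else if i = j then
        -∑ k ∈ G.neighborFinset i, w k i * Real.exp (β * (E i - E k) / 2)
      else 0)
    (H : Matrix S S ℝ)
    (hH : ∀ i j, H i j =
      if G.Adj i j then w i j
      else if i = j then
        -∑ k ∈ G.neighborFinset i, w k i * Real.exp (β * (E i - E k) / 2)
      else 0)
    (d : ℝ) (hd : IsGreatest {r : ℝ | ∃ i j, r = |E i - E j|} d)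
    (wmax : ℝ) (hwmax : IsGreatest {r : ℝ | ∃ i j, G.Adj i j ∧ r = w i j} wmax)
    (χ : ℝ) (hχ : χ = Real.exp (-β * d / 2) / wmax)
    (b : ℝ)
    (hb : IsGreatest {r : ℝ | ∃ i, r = ∑ k ∈ G.neighborFinset i, w k i / wmax} (b - 1))
    (wmin : ℝ) (hwmin : IsLeast {r : ℝ | ∃ i j, G.Adj i j ∧ r = w i j} wmin)
    (δ : ℝ) (hδ : δ = b / (N * (3 * N : ℝ) ^ N))
    (d' : ℝ) (hd' : 0 ≤ d')
    (hratio : Real.exp (-β * d' / 2) ≤ wmin / wmax) :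
    ∀ lam : ℝ, lam < 0 → (∃ v : S → ℝ, v ≠ 0 ∧ M.mulVec v = lam • v) →
      χ * lam ≤ -δ * Real.exp (-β * N * (d + d') / 2) := by
  rintro lam hlam ⟨v, hv, hMv⟩
  obtain ⟨⟨x, y, hxy, hwxy⟩, hwmin⟩ := hwmin
  have hwmin₀ : 0 < wmin := hwxy ▸ hw_pos x y hxy
  have hwle : ∀ i j, G.Adj i j → w i j ≤ wmax := fun i j hij => hwmax.2 ⟨i, j, hij, rfl⟩
  have hwmax₀ : 0 < wmax := (hw_pos x y hxy).trans_le (hwle x y hxy)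
  have hdle : ∀ i j, E i - E j ≤ d := fun i j => (le_abs_self _).trans (hd.2 ⟨i, j, rfl⟩)
  have hd₀ : 0 ≤ d := by simpa using hdle x x
  have hN₂ : 2 ≤ N := by
    have : Nontrivial S := ⟨x, y, hxy.ne⟩
    rw [← hcard]; exact Fintype.one_lt_card
  have hN₂' : (2 : ℝ) ≤ N := by exact_mod_cast hN₂
  obtain ⟨m, hm⟩ := Finite.exists_min E
  -- In the two-state case one endpoint of the edge is the ground state.
  have hsum : ∀ i j, G.Adj i j → E i + E j ≤ 2 * E m + (N - 1) * d := by
    intro i j hij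
    have hi := hdle i m
    have hj := hdle j m
    rcases hN₂.eq_or_lt with h | h
    · have hcases : m = i ∨ m = j := by
        by_contra! hne
        have hle := Finset.card_le_univ ({m, i, j} : Finset S)
        rw [Finset.card_eq_three.mpr ⟨m, i, j, hne.1, hne.2, hij.ne, rfl⟩, hcard] at hle
        omega
      rw [← h]
      rcases hcases with rfl | rfl <;> push_cast <;> linarith
    · have : (3 : ℝ) ≤ N := by exact_mod_cast h
      nlinarith
  have hu : (fun j => Real.exp (β * E j) * v j) ≠ 0 := by
    obtain ⟨i, hi⟩ := Function.ne_iff.mp hv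
    exact Function.ne_iff.mpr ⟨i, mul_ne_zero (Real.exp_ne_zero _) hi⟩
  have hgap := le_neg_eigenvalue_of_conductance hG
    (c := fun i j => if G.Adj i j then w i j * Real.exp (-β * (E i + E j) / 2) else 0)
    (κ := wmin * Real.exp (-β * (2 * E m + (N - 1) * d) / 2))
    (p := fun i => Real.exp (-β * E i)) (P := Real.exp (-β * E m))
    (fun i j => by simp only [G.adj_comm i j, hw_symm i j, add_comm (E i)])
    (fun i j => by
      split_ifs with hij
      · exact mul_nonneg (hw_pos i j hij).le (Real.exp_pos _).le
      · exact le_rfl)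
    (by positivity)
    (fun i j hij => by
      simp only [if_pos hij]
      refine mul_le_mul (hwmin ⟨i, j, hij, rfl⟩) (Real.exp_le_exp.mpr ?_)
        (Real.exp_pos _).le (hw_pos i j hij).le
      nlinarith [hsum i j hij])
    (fun i => Real.exp_pos _)
    (fun i => Real.exp_le_exp.mpr (by nlinarith [hm i]))
    hu hlam (sum_conductance_mul_sub_eq hw_symm hM hMv)
  rw [hcard] at hgap
  have hgap' : wmin * Real.exp (-β * (N - 1) * d / 2) ≤ 2 * (N : ℝ) ^ 3 * (-lam) := by
    refine le_of_mul_le_mul_left ?_ (Real.exp_pos (-β * E m))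
    have : Real.exp (-β * (2 * E m + (N - 1) * d) / 2) =
        Real.exp (-β * E m) * Real.exp (-β * (N - 1) * d / 2) := by
      rw [← Real.exp_add]; ring_nf
    rw [this] at hgap
    linarith
  have hb₀ : b ≤ N := by
    obtain ⟨i, hi⟩ := hb.1
    have h₁ : ∑ k ∈ G.neighborFinset i, w k i / wmax ≤ ∑ _k ∈ G.neighborFinset i, (1 : ℝ) :=
      Finset.sum_le_sum fun k hk => (div_le_one hwmax₀).mpr
        (hwle k i ((G.mem_neighborFinset i k).mp hk).symm)
    have h₂ : ((G.neighborFinset i).card : ℝ) + 1 ≤ N := by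
      have := G.degree_lt_card_verts i
      rw [hcard] at this
      exact_mod_cast this
    simp only [Finset.sum_const, nsmul_eq_mul, mul_one] at h₁
    linarith
  have hpow : 2 * (N : ℝ) ^ 3 ≤ (3 * N : ℝ) ^ N := by
    rcases hN₂.eq_or_lt with h | h
    · subst h; norm_num
    · have h₁ : (3 * N : ℝ) ^ 3 ≤ (3 * N : ℝ) ^ N :=
        pow_le_pow_right₀ (by linarith) h
      have h₂ : 0 ≤ (N : ℝ) ^ 3 := by positivity
      nlinarith
  have hδ₀ : δ ≤ 1 / (2 * (N : ℝ) ^ 3) := by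
    rw [hδ]
    calc b / (N * (3 * N : ℝ) ^ N) ≤ N / (N * (3 * N : ℝ) ^ N) := by gcongr
      _ = 1 / (3 * N : ℝ) ^ N := by field_simp
      _ ≤ 1 / (2 * (N : ℝ) ^ 3) := one_div_le_one_div_of_le (by positivity) hpow
  have hexp : Real.exp (-β * N * (d + d') / 2) ≤
      Real.exp (-β * d / 2) * Real.exp (-β * (N - 1) * d / 2) * Real.exp (-β * d' / 2) := by
    rw [← Real.exp_add, ← Real.exp_add, Real.exp_le_exp]
    nlinarith [mul_nonneg (mul_nonneg hβ.le hd') (by linarith : (0 : ℝ) ≤ N - 1)]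
  have hfinal : δ * Real.exp (-β * N * (d + d') / 2) ≤ χ * (-lam) := by
    calc δ * Real.exp (-β * N * (d + d') / 2)
        ≤ 1 / (2 * (N : ℝ) ^ 3) * (Real.exp (-β * d / 2) *
            Real.exp (-β * (N - 1) * d / 2) * (wmin / wmax)) := by
          refine mul_le_mul hδ₀ (hexp.trans ?_) (Real.exp_pos _).le (by positivity)
          exact mul_le_mul_of_nonneg_left hratio (by positivity)
      _ = χ * (wmin * Real.exp (-β * (N - 1) * d / 2) / (2 * (N : ℝ) ^ 3)) := by
          rw [hχ]; ring
      _ ≤ χ * (-lam) := by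
          refine mul_le_mul_of_nonneg_left ?_ (by rw [hχ]; positivity)
          rw [div_le_iff₀ (by positivity)]
          linarith
  linarith
end

section
/- Regard the Gibbs–Boltzmann distribution as a function of the inverse temperature: ρ̄_i(β) = e^{−βE_i}/Z(β) with Z(β) = Σ_{j∈S} e^{−βE_j}, and let ψ̄^{(0)}_i(β) = 2 ρ̄_i(β)^{1/2} be its 0-representation. Then for every β, the squared Euclidean norm of the derivative of ψ̄^{(0)} with respect to β equals the variance of the energy under ρ̄(β): Σ_{i∈S} (dψ̄^{(0)}_i/dβ)² = Σ_{i∈S} ρ̄_i(β) E_i² − (Σ_{i∈S} ρ̄_i(β) E_i)². -/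
/-- The Gibbs weights `e^{-βE_i} / ∑ j, e^{-βE_j}` satisfy `dρ_i/dβ = ρ_i (⟨E⟩ - E_i)`. -/
theorem hasDerivAt_gibbs {S : Type*} [Fintype S] [Nonempty S] (E : S → ℝ) (β : ℝ) (i : S) :
    HasDerivAt (fun b => Real.exp (-b * E i) / ∑ j, Real.exp (-b * E j))
      (Real.exp (-β * E i) / (∑ j, Real.exp (-β * E j)) *
        ((∑ k, Real.exp (-β * E k) / (∑ j, Real.exp (-β * E j)) * E k) - E i)) β := by
  have hexp (k : S) :
      HasDerivAt (fun b => Real.exp (-b * E k)) (Real.exp (-β * E k) * (-1 * E k)) β :=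
    ((hasDerivAt_neg β).mul_const (E k)).exp
  have hpos : 0 < ∑ j, Real.exp (-β * E j) :=
    Finset.sum_pos (fun j _ => Real.exp_pos _) Finset.univ_nonempty
  have hsum : HasDerivAt (fun b => ∑ j, Real.exp (-b * E j))
      (∑ j, Real.exp (-β * E j) * (-1 * E j)) β :=
    HasDerivAt.fun_sum fun j _ => hexp j
  refine ((hexp i).fun_div hsum hpos.ne').congr_deriv ?_
  have hmean : ∑ k, Real.exp (-β * E k) / (∑ j, Real.exp (-β * E j)) * E k =
      -(∑ j, Real.exp (-β * E j) * (-1 * E j)) / ∑ j, Real.exp (-β * E j) := by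
    rw [← Finset.sum_neg_distrib, Finset.sum_div]
    exact Finset.sum_congr rfl fun k _ => by ring
  rw [hmean]
  field_simp
  ring

/-- The mean squared deviation under weights `p` of total mass one, in terms of moments. -/
theorem sum_mul_sub_mean_sq {S : Type*} [Fintype S] (p E : S → ℝ) (hp : ∑ i, p i = 1) :
    ∑ i, p i * ((∑ k, p k * E k) - E i) ^ 2 =
      ∑ i, p i * E i ^ 2 - (∑ i, p i * E i) ^ 2 := by
  generalize hm : ∑ k, p k * E k = m
  calc ∑ i, p i * (m - E i) ^ 2
      = ∑ i, (m ^ 2 * p i - 2 * m * (p i * E i) + p i * E i ^ 2) :=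
        Finset.sum_congr rfl fun i _ => by ring
    _ = m ^ 2 * ∑ i, p i - 2 * m * ∑ i, p i * E i + ∑ i, p i * E i ^ 2 := by
        rw [Finset.sum_add_distrib, Finset.sum_sub_distrib, ← Finset.mul_sum, ← Finset.mul_sum]
    _ = ∑ i, p i * E i ^ 2 - m ^ 2 := by rw [hp, hm]; ring

/-- The squared Euclidean norm of the `β`-derivative of the 0-representation
`ψ̄⁰_i(β) = 2 √(ρ̄_i(β))` of the Gibbs–Boltzmann distribution equals the
variance of the energy under `ρ̄(β)`. -/
theorem norm_sq_deriv_psi_eq_variance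
    {S : Type*} [Fintype S] [Nonempty S] (E : S → ℝ)
    (Z : ℝ → ℝ) (hZ : ∀ β, Z β = ∑ j, Real.exp (-β * E j))
    (ρ : ℝ → S → ℝ) (hρ : ∀ β i, ρ β i = Real.exp (-β * E i) / Z β)
    (ψ : ℝ → S → ℝ) (hψ : ∀ β i, ψ β i = 2 * Real.sqrt (ρ β i)) :
    ∀ β : ℝ, ∑ i, (deriv (fun b => ψ b i) β) ^ 2 =
      ∑ i, ρ β i * E i ^ 2 - (∑ i, ρ β i * E i) ^ 2 := by
  intro β
  have hZpos : 0 < Z β := by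
    rw [hZ]
    exact Finset.sum_pos (fun j _ => Real.exp_pos _) Finset.univ_nonempty
  have hρpos (i : S) : 0 < ρ β i := by
    rw [hρ]
    exact div_pos (Real.exp_pos _) hZpos
  have hρsum : ∑ i, ρ β i = 1 := by
    simp only [hρ]
    rw [← Finset.sum_div, ← hZ, div_self hZpos.ne']
  have hρderiv (i : S) :
      HasDerivAt (fun b => ρ b i) (ρ β i * ((∑ k, ρ β k * E k) - E i)) β := by
    simp only [hρ, hZ]
    exact hasDerivAt_gibbs E β i
  rw [← sum_mul_sub_mean_sq (ρ β) E hρsum]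
  refine Finset.sum_congr rfl fun i _ => ?_
  simp only [hψ]
  rw [(((hρderiv i).sqrt (hρpos i).ne').const_mul 2).deriv]
  have hsqrt : Real.sqrt (ρ β i) ^ 2 = ρ β i := Real.sq_sqrt (hρpos i).le
  have hne : ρ β i ≠ 0 := (hρpos i).ne'
  rw [mul_pow, div_pow, mul_pow, mul_pow, hsqrt]
  field_simp
end

section
/- Suppose the energy function E is not constant, let E_min = min_{i∈S} E_i, and let g = min{E_i − E_min : i ∈ S, E_i > E_min} > 0 be the gap between the lowest and second lowest energies. Then there exists a constant C > 0, independent of β, such that for all β ≥ 0 the variance of E under the Gibbs–Boltzmann distribution ρ̄(β) satisfies Σ_{i∈S} ρ̄_i(β) E_i² − (Σ_{i∈S} ρ̄_i(β) E_i)² ≤ C² e^{−βg}. -/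
/-- The variance of `x` under weights `p` of total mass one is at most its second moment
about any point `a`. -/
theorem variance_le_second_moment_about {S : Type*} [Fintype S] (p x : S → ℝ)
    (hp : ∑ i, p i = 1) (a : ℝ) :
    ∑ i, p i * x i ^ 2 - (∑ i, p i * x i) ^ 2 ≤ ∑ i, p i * (x i - a) ^ 2 := by
  have h : ∑ i, p i * (x i - a) ^ 2 =
      ∑ i, p i * x i ^ 2 - 2 * a * ∑ i, p i * x i + a ^ 2 * ∑ i, p i := by
    simp only [Finset.mul_sum, ← Finset.sum_sub_distrib, ← Finset.sum_add_distrib]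
    exact Finset.sum_congr rfl fun i _ => by ring
  rw [h, hp]
  nlinarith [sq_nonneg (∑ i, p i * x i - a)]

/-- A Gibbs weight is at most the Boltzmann factor of the energy difference to any
reference state. -/
theorem gibbs_weight_le_exp {S : Type*} [Fintype S] (E : S → ℝ) (β : ℝ) (i k : S) :
    Real.exp (-β * E i) / ∑ j, Real.exp (-β * E j) ≤ Real.exp (-β * (E i - E k)) := by
  have hk : Real.exp (-β * E k) ≤ ∑ j, Real.exp (-β * E j) :=
    Finset.single_le_sum (f := fun j => Real.exp (-β * E j))
      (fun j _ => (Real.exp_pos _).le) (Finset.mem_univ k)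
  rw [div_le_iff₀ ((Real.exp_pos _).trans_le hk)]
  calc Real.exp (-β * E i)
      = Real.exp (-β * (E i - E k)) * Real.exp (-β * E k) := by
        rw [← Real.exp_add]; congr 1; ring
    _ ≤ _ := by gcongr

/-- If the energy `E` is not constant, with `g` the gap between the lowest and
second lowest energy values, there is a constant `C > 0` independent of `β`
such that for all `β ≥ 0` the energy variance under the Gibbs–Boltzmann
distribution is at most `C² e^{-β g}`. -/
theorem variance_exponential_bound
    {S : Type*} [Fintype S] [Nonempty S] (E : S → ℝ)
    (hE : ∃ i j, E i ≠ E j)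
    (Emin : ℝ) (hEmin : IsLeast (Set.range E) Emin)
    (g : ℝ) (hg : IsLeast {r : ℝ | ∃ i, Emin < E i ∧ r = E i - Emin} g)
    (Z : ℝ → ℝ) (hZ : ∀ β, Z β = ∑ j, Real.exp (-β * E j))
    (ρ : ℝ → S → ℝ) (hρ : ∀ β i, ρ β i = Real.exp (-β * E i) / Z β) :
    0 < g ∧ ∃ C : ℝ, 0 < C ∧ ∀ β : ℝ, 0 ≤ β →
      ∑ i, ρ β i * E i ^ 2 - (∑ i, ρ β i * E i) ^ 2 ≤ C ^ 2 * Real.exp (-β * g) := by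
  obtain ⟨⟨i₀, hi₀, rfl⟩, hgap⟩ := hg
  obtain ⟨⟨k, rfl⟩, hmin⟩ := hEmin
  have hK : 0 ≤ ∑ i, (E i - E k) ^ 2 := Finset.sum_nonneg fun i _ => sq_nonneg _
  refine ⟨sub_pos.2 hi₀, √(∑ i, (E i - E k) ^ 2 + 1), by positivity, fun β hβ => ?_⟩
  rw [Real.sq_sqrt (by positivity)]
  have hsum : ∑ i, ρ β i = 1 := by
    simp only [hρ, ← Finset.sum_div, hZ]
    exact div_self (Finset.sum_pos (fun j _ => Real.exp_pos _) Finset.univ_nonempty).ne'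
  calc ∑ i, ρ β i * E i ^ 2 - (∑ i, ρ β i * E i) ^ 2
      ≤ ∑ i, ρ β i * (E i - E k) ^ 2 := variance_le_second_moment_about _ _ hsum _
    _ ≤ ∑ i, (E i - E k) ^ 2 * Real.exp (-β * (E i₀ - E k)) := by
        refine Finset.sum_le_sum fun i _ => ?_
        rcases (hmin ⟨i, rfl⟩ : E k ≤ E i).eq_or_lt with h | h
        · simp [h]
        · rw [mul_comm]
          refine mul_le_mul_of_nonneg_left ?_ (sq_nonneg _)
          rw [hρ, hZ]
          refine (gibbs_weight_le_exp E β i k).trans (Real.exp_le_exp.2 ?_)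
          exact mul_le_mul_of_nonpos_left (hgap ⟨i, h, rfl⟩) (neg_nonpos.2 hβ)
    _ ≤ (∑ i, (E i - E k) ^ 2 + 1) * Real.exp (-β * (E i₀ - E k)) := by
        rw [← Finset.sum_mul]
        gcongr
        linarith
end
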